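/- Let α = (1+√5)/2 be the golden ratio. There exists c ∈ ℝ with 0 < c < 1 such that the ellipse {z ∈ ℂ : |z − c| + |z + c| = 1 + c²} (the Blaschke 3-ellipse associated with the Blaschke product B(z) = z·((z−c)/(1−cz))·((z+c)/(1+cz))) is a golden ellipse; explicitly, its semi-major axis A = (1 + c²)/2 and semi-minor axis B = √(A² − c²) satisfy A = α·B. -/

import Mathlib

open Complex

/-- Every ratio `α > 1` is the axis ratio of the Blaschke 3-ellipse with foci `±c`, for some
`c ∈ (0, 1)`; explicitly `c ^ 2 = (α - 1) / (α + 1)`. -/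
lemma exists_blaschke_ellipse_axis_ratio {α : ℝ} (hα : 1 < α) :
    ∃ c : ℝ, 0 < c ∧ c < 1 ∧
      (1 + c ^ 2) / 2 = α * Real.sqrt (((1 + c ^ 2) / 2) ^ 2 - c ^ 2) := by
  have hpos : 0 < (α - 1) / (α + 1) := div_pos (by linarith) (by linarith)
  have hlt : (α - 1) / (α + 1) < 1 := by rw [div_lt_one (by linarith)]; linarith
  refine ⟨Real.sqrt ((α - 1) / (α + 1)), Real.sqrt_pos.2 hpos,
    (Real.sqrt_lt' one_pos).2 (by simpa using hlt), ?_⟩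
  rw [Real.sq_sqrt hpos.le]
  have hsq (x : ℝ) : ((1 + x) / 2) ^ 2 - x = ((1 - x) / 2) ^ 2 := by ring
  rw [hsq, Real.sqrt_sq (by linarith)]
  have : α + 1 ≠ 0 := by linarith
  field_simp
  ring

theorem golden_blaschke_ellipse_exists (α : ℝ) (hα : α = (1 + Real.sqrt 5) / 2) :
    ∃ c : ℝ, 0 < c ∧ c < 1 ∧
      (1 + c ^ 2) / 2 = α * Real.sqrt (((1 + c ^ 2) / 2) ^ 2 - c ^ 2) := by
  have h : 1 < Real.sqrt 5 := Real.lt_sqrt_of_sq_lt (by norm_num)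
  exact exists_blaschke_ellipse_axis_ratio (by linarith)
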